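/- Let Γ be a discrete subgroup of SL(2,ℝ) acting on the upper half-plane ℍ, with Γ·i bounded in ℂ and limit set L(Γ) containing at least 3 points. If t ≥ 0, C > 0 and r₀ > 0 are such that V(L(Γ)_r) ≤ C·r^{2−t} for all 0 < r < r₀, then for every s > t the Poincaré series converges: Σ_{g ∈ Γ} exp(−s·d(i, g·i)) < ∞. -/

import Mathlib

open UpperHalfPlane MeasureTheory Metric Filter

/-- A subgroup of `SL(2,ℝ)` is discrete (Kleinian/Fuchsian) if it is a discrete subset of
`SL(2,ℝ)`, viewed inside the space of 2×2 real matrices. -/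
def IsDiscreteSubgroup (Γ : Subgroup (Matrix.SpecialLinearGroup (Fin 2) ℝ)) : Prop :=
  DiscreteTopology
    (Set.range fun g : Γ => ((g : Matrix.SpecialLinearGroup (Fin 2) ℝ) : Matrix (Fin 2) (Fin 2) ℝ))

/-- The orbit of the base point `i ∈ ℍ` under a subgroup `Γ ≤ SL(2,ℝ)`, viewed in `ℂ`. -/
def orbitOfI (Γ : Subgroup (Matrix.SpecialLinearGroup (Fin 2) ℝ)) : Set ℂ :=
  Set.range fun g : Γ =>
    (((g : Matrix.SpecialLinearGroup (Fin 2) ℝ) • UpperHalfPlane.I : UpperHalfPlane) : ℂ)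

/-- The limit set of `Γ`: accumulation points of the orbit `Γ·i` in `ℂ`. -/
def limitSet (Γ : Subgroup (Matrix.SpecialLinearGroup (Fin 2) ℝ)) : Set ℂ :=
  closure (orbitOfI Γ) \ orbitOfI Γ

open Topology

open scoped MatrixGroups

lemma UpperHalfPlane.two_mul_im_mul_cosh_dist_I (z : ℍ) :
    2 * z.im * Real.cosh (dist I z) = ‖(z : ℂ)‖ ^ 2 + 1 := by
  have hz := z.im_pos
  rw [cosh_dist, Complex.dist_eq, ← Complex.normSq_eq_norm_sq, ← Complex.normSq_eq_norm_sq,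
    Complex.normSq_apply, Complex.normSq_apply]
  simp only [Complex.sub_re, Complex.sub_im, coe_I, Complex.I_re, Complex.I_im, coe_re, coe_im,
    I_im]
  field_simp
  ring

lemma UpperHalfPlane.exp_neg_dist_I_le (z : ℍ) : Real.exp (-dist I z) ≤ 2 * z.im := by
  have h := two_mul_im_mul_cosh_dist_I z
  have hz := z.im_pos
  have hcosh : Real.cosh (dist I z) ≤ Real.exp (dist I z) := by
    rw [← Real.cosh_add_sinh]
    linarith [Real.sinh_nonneg_iff.2 (dist_nonneg : 0 ≤ dist I z)]
  rw [Real.exp_neg, inv_le_iff_one_le_mul₀ (Real.exp_pos _)]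
  nlinarith [sq_nonneg ‖(z : ℂ)‖]

lemma UpperHalfPlane.im_le_mul_exp_neg_dist_I (z : ℍ) :
    z.im ≤ (‖(z : ℂ)‖ ^ 2 + 1) * Real.exp (-dist I z) := by
  have hz := z.im_pos
  rw [Real.exp_neg, ← div_eq_mul_inv, le_div_iff₀ (Real.exp_pos _),
    ← two_mul_im_mul_cosh_dist_I, Real.cosh_eq]
  nlinarith [Real.exp_pos (-dist I z)]

/-- Euclidean balls around two points of `ℍ`, with radius at most half the height of the centre,
can only meet if the centres are at bounded hyperbolic distance. -/
lemma UpperHalfPlane.dist_le_of_dist_coe_le {z w : ℍ} {x : ℂ} (hz : dist x z ≤ z.im / 2)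
    (hw : dist x w ≤ w.im / 2) : dist z w ≤ 14 := by
  have hz0 := z.im_pos
  have hw0 := w.im_pos
  have hzw : dist (z : ℂ) w ≤ (z.im + w.im) / 2 := by
    linarith [dist_triangle_left (z : ℂ) w x]
  have him : |z.im - w.im| ≤ (z.im + w.im) / 2 := by
    refine le_trans ?_ hzw
    rw [Complex.dist_eq]
    simpa using Complex.abs_im_le_norm ((z : ℂ) - w)
  obtain ⟨h₁, h₂⟩ := abs_le.1 him
  have hcosh : Real.cosh (dist z w) ≤ 7 := by
    rw [cosh_dist]
    have : dist (z : ℂ) w ^ 2 / (2 * z.im * w.im) ≤ 6 := by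
      rw [div_le_iff₀ (by positivity)]
      have : dist (z : ℂ) w ^ 2 ≤ ((z.im + w.im) / 2) ^ 2 := by gcongr
      nlinarith [mul_nonneg (show 0 ≤ 3 * w.im - z.im by linarith)
        (show 0 ≤ 3 * z.im - w.im by linarith), mul_pos hz0 hw0]
    linarith
  rw [Real.cosh_eq] at hcosh
  linarith [Real.add_one_le_exp (dist z w), Real.exp_pos (-dist z w)]

lemma IsDiscreteSubgroup.discreteTopology {Γ : Subgroup SL(2, ℝ)} (h : IsDiscreteSubgroup Γ) :
    DiscreteTopology Γ := by
  have hcont : Continuous fun g : Γ => ((g : SL(2, ℝ)) : Matrix (Fin 2) (Fin 2) ℝ) :=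
    continuous_subtype_val.comp continuous_subtype_val
  have : DiscreteTopology (Set.range fun g : Γ => ((g : SL(2, ℝ)) : Matrix (Fin 2) (Fin 2) ℝ)) := h
  refine DiscreteTopology.of_continuous_injective
    (β := Set.range fun g : Γ => ((g : SL(2, ℝ)) : Matrix (Fin 2) (Fin 2) ℝ))
    (hcont.subtype_mk fun g => ⟨g, rfl⟩) ?_
  intro g h hgh
  have hval := Subtype.ext_iff.1 hgh
  exact Subtype.ext (Subtype.ext hval)

lemma IsDiscreteSubgroup.finite_dist_smul_le {Γ : Subgroup SL(2, ℝ)} (h : IsDiscreteSubgroup Γ)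
    (z : ℍ) (R : ℝ) : {g : Γ | dist z ((g : SL(2, ℝ)) • z) ≤ R}.Finite := by
  have := h.discreteTopology
  refine (ProperlyDiscontinuousSMul.finite_disjoint_inter_image (Γ := Γ)
    (isCompact_singleton (x := z)) (isCompact_closedBall z R)).subset fun g hg => ?_
  refine ⟨(g : SL(2, ℝ)) • z, ⟨z, rfl, rfl⟩, ?_⟩
  simpa [dist_comm] using hg

lemma coe_smul_eq_div (g : SL(2, ℝ)) (z : ℍ) : ((g • z : ℍ) : ℂ) =
    ((g 0 0 : ℂ) * z + g 0 1) / ((g 1 0 : ℂ) * z + g 1 1) := by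
  simpa using coe_specialLinearGroup_apply g z

lemma Matrix.SpecialLinearGroup.complex_det_eq_one (g : SL(2, ℝ)) :
    (g 0 0 : ℂ) * g 1 1 - g 0 1 * g 1 0 = 1 := by
  have := g.det_coe
  rw [Matrix.det_fin_two] at this
  exact_mod_cast this

lemma denom_coe_ne_zero (g : SL(2, ℝ)) (z : ℍ) : (g 1 0 : ℂ) * z + g 1 1 ≠ 0 := by
  intro h
  have him : g 1 0 * z.im = 0 := by simpa using congrArg Complex.im h
  have hc : g 1 0 = 0 := (mul_eq_zero.1 him).resolve_right z.im_ne_zero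
  have hd : g 1 1 = 0 := by simpa [hc] using h
  simpa [hc, hd] using g.complex_det_eq_one

/-- If the orbit is bounded, the limit set is invariant under the (nonsingular) action. -/
lemma limitSet_invariant {Γ : Subgroup SL(2, ℝ)} (hbdd : Bornology.IsBounded (orbitOfI Γ))
    {a : ℂ} (ha : a ∈ limitSet Γ) {g : SL(2, ℝ)} (hg : g ∈ Γ) :
    (g 1 0 : ℂ) * a + g 1 1 ≠ 0 ∧
      ((g 0 0 : ℂ) * a + g 0 1) / ((g 1 0 : ℂ) * a + g 1 1) ∈ limitSet Γ := by
  obtain ⟨ha₁, ha₂⟩ := ha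
  have hdet := g.complex_det_eq_one
  obtain ⟨u, hu, hlim⟩ := mem_closure_iff_seq_limit.1 ha₁
  choose k hk using hu
  have hgk (n : ℕ) : ((g 0 0 : ℂ) * u n + g 0 1) / ((g 1 0 : ℂ) * u n + g 1 1) ∈ orbitOfI Γ := by
    refine ⟨⟨g, hg⟩ * k n, ?_⟩
    simp only [← hk n, ← coe_smul_eq_div, Subgroup.coe_mul, mul_smul]
  have hne (n : ℕ) : (g 1 0 : ℂ) * u n + g 1 1 ≠ 0 := by
    rw [← hk n]
    exact denom_coe_ne_zero _ _
  have hnum : Tendsto (fun n => (g 0 0 : ℂ) * u n + g 0 1) atTop (𝓝 ((g 0 0 : ℂ) * a + g 0 1)) :=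
    (hlim.const_mul _).add_const _
  have hden : Tendsto (fun n => (g 1 0 : ℂ) * u n + g 1 1) atTop (𝓝 ((g 1 0 : ℂ) * a + g 1 1)) :=
    (hlim.const_mul _).add_const _
  have hd0 : (g 1 0 : ℂ) * a + g 1 1 ≠ 0 := by
    intro h0
    obtain ⟨R, hR⟩ := hbdd.exists_norm_le
    have hzero : Tendsto (fun n => (g 0 0 : ℂ) * u n + g 0 1) atTop (𝓝 0) := by
      refine squeeze_zero_norm (a := fun n => R * ‖(g 1 0 : ℂ) * u n + g 1 1‖) (fun n => ?_) ?_
      · have := hR _ (hgk n)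
        rwa [norm_div, div_le_iff₀ (norm_pos_iff.2 (hne n))] at this
      · simpa [h0] using hden.norm.const_mul R
    have hn0 := tendsto_nhds_unique hnum hzero
    have : (1 : ℂ) = 0 := by
      linear_combination (-1 : ℂ) * hdet + (g 0 0 : ℂ) * h0 - (g 1 0 : ℂ) * hn0
    exact one_ne_zero this
  refine ⟨hd0, mem_closure_of_tendsto (hnum.div hden hd0) (.of_forall hgk), ?_⟩
  rintro ⟨m, hm⟩
  apply ha₂
  refine ⟨(⟨g, hg⟩ : Γ)⁻¹ * m, ?_⟩
  set z : ℍ := (m : SL(2, ℝ)) • I with hz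
  have hback := coe_smul_eq_div g (g⁻¹ • z)
  rw [smul_inv_smul] at hback
  set w : ℍ := g⁻¹ • z with hw
  have hw0 := denom_coe_ne_zero g w
  have heq : ((g 0 0 : ℂ) * w + g 0 1) / ((g 1 0 : ℂ) * w + g 1 1) =
      ((g 0 0 : ℂ) * a + g 0 1) / ((g 1 0 : ℂ) * a + g 1 1) := by rw [← hback, ← hm]
  rw [div_eq_div_iff hw0 hd0] at heq
  have : (w : ℂ) = a := by linear_combination heq - ((w : ℂ) - a) * hdet
  rw [← this]
  simp only [Subgroup.coe_mul, mul_smul, hw, hz, Subgroup.coe_inv]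

/-- Two distinct points cannot both be close to the pole of `g`, relative to the size of the
bottom row of `g`. -/
lemma norm_denom_I_le {a b : ℂ} (c d : ℝ) :
    ‖a - b‖ * ‖(c : ℂ) * Complex.I + d‖ ≤
      (2 + ‖a‖ + ‖b‖) * max ‖(c : ℂ) * a + d‖ ‖(c : ℂ) * b + d‖ := by
  set m := max ‖(c : ℂ) * a + d‖ ‖(c : ℂ) * b + d‖
  have hma : ‖(c : ℂ) * a + d‖ ≤ m := le_max_left _ _
  have hmb : ‖(c : ℂ) * b + d‖ ≤ m := le_max_right _ _
  have key : (a - b) * ((c : ℂ) * Complex.I + d) =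
      (Complex.I - b) * ((c : ℂ) * a + d) + (a - Complex.I) * ((c : ℂ) * b + d) := by ring
  have h₁ : ‖Complex.I - b‖ ≤ 1 + ‖b‖ := by simpa using norm_sub_le Complex.I b
  have h₂ : ‖a - Complex.I‖ ≤ ‖a‖ + 1 := by simpa using norm_sub_le a Complex.I
  calc ‖a - b‖ * ‖(c : ℂ) * Complex.I + d‖
      ≤ ‖Complex.I - b‖ * ‖(c : ℂ) * a + d‖ + ‖a - Complex.I‖ * ‖(c : ℂ) * b + d‖ := by
        rw [← norm_mul, ← norm_mul, ← norm_mul, key]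
        exact norm_add_le _ _
    _ ≤ (1 + ‖b‖) * m + (‖a‖ + 1) * m := by gcongr
    _ = _ := by ring

lemma im_smul_I_mul_norm_sq (g : SL(2, ℝ)) :
    (g • I : ℍ).im * ‖(g 1 0 : ℂ) * Complex.I + g 1 1‖ ^ 2 = 1 := by
  have h0 := denom_coe_ne_zero g I
  rw [coe_I] at h0
  rw [← coe_im, coe_smul_eq_div, ← Complex.normSq_eq_norm_sq, Complex.div_im, coe_I]
  have h1 : Complex.normSq ((g 1 0 : ℂ) * Complex.I + g 1 1) ≠ 0 := by
    simpa only [ne_eq, Complex.normSq_eq_zero] using h0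
  have hdet := g.det_coe
  rw [Matrix.det_fin_two] at hdet
  rw [← sub_div, div_mul_cancel₀ _ h1]
  simp
  linarith

/-- The Euclidean distance from a point of a bounded orbit to the limit set is bounded by a
multiple of its height. -/
lemma exists_dist_limitSet_le {Γ : Subgroup SL(2, ℝ)} (hbdd : Bornology.IsBounded (orbitOfI Γ))
    (hL : (limitSet Γ).Nontrivial) : ∃ D, 0 < D ∧ ∀ g ∈ Γ, ∃ w ∈ limitSet Γ,
      dist ((g • I : ℍ) : ℂ) w ≤ D * (g • I : ℍ).im := by
  obtain ⟨a, ha, b, hb, hab⟩ := hL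
  have hab' : 0 < ‖a - b‖ := norm_pos_iff.2 (sub_ne_zero.2 hab)
  set P := 2 + ‖a‖ + ‖b‖ with hP
  refine ⟨P ^ 2 / ‖a - b‖, by positivity, fun g hg => ?_⟩
  obtain ⟨e, he, hnorm, hbound⟩ : ∃ e ∈ limitSet Γ, ‖e‖ + 1 ≤ P ∧
      ‖a - b‖ * ‖(g 1 0 : ℂ) * Complex.I + g 1 1‖ ≤ P * ‖(g 1 0 : ℂ) * e + g 1 1‖ := by
    have key := norm_denom_I_le (a := a) (b := b) (g 1 0) (g 1 1)
    rcases max_choice ‖(g 1 0 : ℂ) * a + g 1 1‖ ‖(g 1 0 : ℂ) * b + g 1 1‖ with h | h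
    · exact ⟨a, ha, by linarith [norm_nonneg b], by rwa [h] at key⟩
    · exact ⟨b, hb, by linarith [norm_nonneg a], by rwa [h] at key⟩
  obtain ⟨hne, hmem⟩ := limitSet_invariant hbdd he hg
  refine ⟨_, hmem, ?_⟩
  have hI := denom_coe_ne_zero g I
  rw [coe_I] at hI
  have hdet := g.complex_det_eq_one
  have hsub : ((g 0 0 : ℂ) * Complex.I + g 0 1) / ((g 1 0 : ℂ) * Complex.I + g 1 1) -
      ((g 0 0 : ℂ) * e + g 0 1) / ((g 1 0 : ℂ) * e + g 1 1) =
      (Complex.I - e) / (((g 1 0 : ℂ) * Complex.I + g 1 1) * ((g 1 0 : ℂ) * e + g 1 1)) := by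
    rw [div_sub_div _ _ hI hne]
    congr 1
    linear_combination (Complex.I - e) * hdet
  have hIe : ‖Complex.I - e‖ ≤ P := by
    have : ‖Complex.I - e‖ ≤ 1 + ‖e‖ := by simpa using norm_sub_le Complex.I e
    linarith
  rw [Complex.dist_eq, coe_smul_eq_div, coe_I, hsub, norm_div, norm_mul]
  have him := im_smul_I_mul_norm_sq g
  have hN : 0 < ‖(g 1 0 : ℂ) * Complex.I + g 1 1‖ := norm_pos_iff.2 hI
  have hQ : 0 < ‖(g 1 0 : ℂ) * e + g 1 1‖ := norm_pos_iff.2 hne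
  rw [eq_div_of_mul_eq (by positivity) him]
  set N := ‖(g 1 0 : ℂ) * Complex.I + g 1 1‖
  set Q := ‖(g 1 0 : ℂ) * e + g 1 1‖
  rw [div_mul_div_comm, mul_one, div_le_div_iff₀ (by positivity) (by positivity)]
  calc ‖Complex.I - e‖ * (‖a - b‖ * N ^ 2) ≤ P * ((P * Q) * N) := by
        rw [pow_two, ← mul_assoc ‖a - b‖]
        gcongr
    _ = P ^ 2 * (N * Q) := by ring

/-- A finite family of subsets of `U` with multiplicity at most `M` has total measure at most
`M * μ U`. -/
lemma MeasureTheory.sum_measure_le_mul_of_multiplicity {α ι : Type*} [MeasurableSpace α]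
    (μ : Measure α) (F : Finset ι) (B : ι → Set α) (hB : ∀ i ∈ F, MeasurableSet (B i))
    {U : Set α} (hU : ∀ i ∈ F, B i ⊆ U) (hUm : MeasurableSet U) (M : ℕ)
    (hM : ∀ x, {i : ι | i ∈ F ∧ x ∈ B i}.encard ≤ M) :
    ∑ i ∈ F, μ (B i) ≤ M * μ U := by
  classical
  calc ∑ i ∈ F, μ (B i) = ∑ i ∈ F, ∫⁻ x, (B i).indicator 1 x ∂μ :=
        Finset.sum_congr rfl fun i hi => (lintegral_indicator_one (hB i hi)).symm
    _ = ∫⁻ x, ∑ i ∈ F, (B i).indicator 1 x ∂μ :=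
        (lintegral_finsetSum' F fun i hi => (measurable_one.indicator (hB i hi)).aemeasurable).symm
    _ ≤ ∫⁻ x, U.indicator (fun _ => (M : ENNReal)) x ∂μ := by
        refine lintegral_mono fun x => ?_
        by_cases hx : x ∈ U
        · have hcard : ((F.filter fun i => x ∈ B i).card : ℕ∞) ≤ M := by
            rw [← Set.encard_coe_eq_coe_finsetCard]
            simpa using hM x
          simp only [Set.indicator_of_mem hx, Set.indicator_apply, Pi.one_apply, Finset.sum_boole]
          exact_mod_cast hcard
        · rw [Finset.sum_eq_zero fun i hi =>
            Set.indicator_of_notMem (fun h => hx (hU i hi h)) _]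
          exact zero_le
    _ = M * μ U := lintegral_indicator_const hUm _

/-- The number of elements of a discrete group moving `I` by a distance in `[n, n + 1)` grows at
most like `exp (t * n)`, where `t` is the exponent in the volume bound. -/
lemma exists_card_shell_le {Γ : Subgroup SL(2, ℝ)} (hdisc : IsDiscreteSubgroup Γ)
    (hbdd : Bornology.IsBounded (orbitOfI Γ)) (hL : (limitSet Γ).Nontrivial)
    {t : ℝ} (ht : 0 ≤ t) {C : ℝ} (hC : 0 < C) {r₀ : ℝ} (hr₀ : 0 < r₀)
    (hvol : ∀ r : ℝ, 0 < r → r < r₀ →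
      volume (cthickening r (limitSet Γ)) ≤ ENNReal.ofReal (C * r ^ (2 - t))) :
    ∃ K : ℝ, 0 ≤ K ∧ ∀ (n : ℕ) (F : Finset Γ),
      (∀ g ∈ F, n ≤ dist I ((g : SL(2, ℝ)) • I) ∧ dist I ((g : SL(2, ℝ)) • I) < n + 1) →
      (F.card : ℝ) ≤ K * Real.exp (t * n) := by
  obtain ⟨R, hR⟩ := hbdd.exists_norm_le
  obtain ⟨D, hD, hDL⟩ := exists_dist_limitSet_le hbdd hL
  set B := D * (R ^ 2 + 1) + 1 with hB
  have hB0 : 0 < B := by positivity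
  have hfin := hdisc.finite_dist_smul_le I 14
  set M := hfin.toFinset.card with hM
  have hlim : Tendsto (fun n : ℕ => B * Real.exp (-(n : ℝ))) atTop (𝓝 0) := by
    simpa using (Real.tendsto_exp_neg_atTop_nhds_zero.comp tendsto_natCast_atTop_atTop).const_mul B
  obtain ⟨n₀, hn₀⟩ := eventually_atTop.1 (hlim.eventually_lt_const hr₀)
  have hfin₀ := hdisc.finite_dist_smul_le I (n₀ + 1)
  have hK₁ : 0 ≤ M * C * B ^ (2 - t) * 16 * Real.exp 2 / Real.pi := by positivity
  refine ⟨hfin₀.toFinset.card + M * C * B ^ (2 - t) * 16 * Real.exp 2 / Real.pi, by positivity,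
    fun n F hF => ?_⟩
  rw [add_mul]
  rcases lt_or_ge n n₀ with hn | hn
  · have hcard : (F.card : ℝ) ≤ hfin₀.toFinset.card := by
      have hn' : (n : ℝ) ≤ n₀ := by exact_mod_cast hn.le
      exact_mod_cast Finset.card_le_card fun g hg => by
        simpa using (hF g hg).2.le.trans (by linarith)
    have : (1 : ℝ) ≤ Real.exp (t * n) := Real.one_le_exp (by positivity)
    have h₁ := le_mul_of_one_le_right (Nat.cast_nonneg (α := ℝ) hfin₀.toFinset.card) this
    have h₂ := mul_nonneg hK₁ (Real.exp_pos (t * n)).le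
    linarith
  set ρ := Real.exp (-(n + 1 : ℝ)) / 4 with hρ
  have hρ0 : 0 < ρ := by positivity
  have hρim : ∀ g ∈ F, ρ ≤ ((g : SL(2, ℝ)) • I : ℍ).im / 2 := fun g hg => by
    have h₁ := exp_neg_dist_I_le ((g : SL(2, ℝ)) • I)
    have h₂ : Real.exp (-(n + 1 : ℝ)) ≤ Real.exp (-dist I ((g : SL(2, ℝ)) • I)) :=
      Real.exp_le_exp.2 (by linarith [(hF g hg).2])
    linarith
  have hsub : ∀ g ∈ F, closedBall (((g : SL(2, ℝ)) • I : ℍ) : ℂ) ρ ⊆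
      cthickening (B * Real.exp (-(n : ℝ))) (limitSet Γ) := fun g hg x hx => by
    obtain ⟨w, hw, hgw⟩ := hDL g g.2
    refine mem_cthickening_of_dist_le x w _ _ hw ?_
    have hnorm := hR _ ⟨g, rfl⟩
    have him : ((g : SL(2, ℝ)) • I : ℍ).im ≤ (R ^ 2 + 1) * Real.exp (-(n : ℝ)) := by
      refine (im_le_mul_exp_neg_dist_I _).trans ?_
      gcongr
      exact (hF g hg).1
    have hρn : ρ ≤ Real.exp (-(n : ℝ)) := by
      have : Real.exp (-(n + 1 : ℝ)) ≤ Real.exp (-(n : ℝ)) := Real.exp_le_exp.2 (by linarith)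
      linarith [Real.exp_pos (-(n : ℝ))]
    calc dist x w ≤ dist x ((g : SL(2, ℝ)) • I : ℍ) + dist (((g : SL(2, ℝ)) • I : ℍ) : ℂ) w :=
          dist_triangle _ _ _
      _ ≤ Real.exp (-(n : ℝ)) + D * ((R ^ 2 + 1) * Real.exp (-(n : ℝ))) :=
          add_le_add ((mem_closedBall.1 hx).trans hρn)
            (hgw.trans (mul_le_mul_of_nonneg_left him hD.le))
      _ = B * Real.exp (-(n : ℝ)) := by rw [hB]; ring
  have hmult : ∀ x : ℂ, {g : Γ | g ∈ F ∧
      x ∈ closedBall (((g : SL(2, ℝ)) • I : ℍ) : ℂ) ρ}.encard ≤ M := fun x => by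
    rcases Set.eq_empty_or_nonempty {g : Γ | g ∈ F ∧
      x ∈ closedBall (((g : SL(2, ℝ)) • I : ℍ) : ℂ) ρ} with h | ⟨g₀, hg₀, hx₀⟩
    · rw [h, Set.encard_empty]
      exact zero_le
    · rw [hM, ← Set.encard_coe_eq_coe_finsetCard]
      refine Set.encard_le_encard_of_injOn (f := fun g => g₀⁻¹ * g) ?_ (mul_right_injective _).injOn
      rintro g ⟨hg, hx⟩
      have hdist : dist ((g₀ : SL(2, ℝ)) • I) ((g : SL(2, ℝ)) • I) ≤ 14 :=
        dist_le_of_dist_coe_le (hx₀.trans (hρim g₀ hg₀)) (hx.trans (hρim g hg))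
      rw [← dist_smul (g₀ : SL(2, ℝ))⁻¹, inv_smul_smul, ← mul_smul] at hdist
      simpa using hdist
  have hsum := (sum_measure_le_mul_of_multiplicity volume F _
    (fun g _ => isClosed_closedBall.measurableSet) hsub isClosed_cthickening.measurableSet M
    hmult).trans (mul_le_mul_right (hvol _ (by positivity) (hn₀ n hn)) _)
  have hreal : F.card * (ρ ^ 2 * Real.pi) ≤ M * (C * (B * Real.exp (-(n : ℝ))) ^ (2 - t)) := by
    rw [← ENNReal.ofReal_le_ofReal_iff (by positivity), ENNReal.ofReal_mul (Nat.cast_nonneg _),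
      ENNReal.ofReal_mul (Nat.cast_nonneg _), ENNReal.ofReal_natCast, ENNReal.ofReal_natCast,
      ENNReal.ofReal_mul (by positivity), ENNReal.ofReal_pow hρ0.le]
    simpa [Complex.volume_closedBall, ← NNReal.coe_real_pi, ENNReal.ofReal_coe_nnreal] using hsum
  rw [Real.mul_rpow hB0.le (Real.exp_pos _).le, ← Real.exp_mul] at hreal
  have hρ2 : ρ ^ 2 = Real.exp (-(2 * n) - 2) / 16 := by
    rw [hρ, div_pow, ← Real.exp_nat_mul]
    norm_num
    ring_nf
  have hexp : Real.exp (-(n : ℝ) * (2 - t)) =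
      Real.exp (t * n) * Real.exp 2 * Real.exp (-(2 * n) - 2) := by
    rw [← Real.exp_add, ← Real.exp_add]
    ring_nf
  rw [hρ2, hexp] at hreal
  have hle : (F.card : ℝ) ≤
      M * C * B ^ (2 - t) * 16 * Real.exp 2 / Real.pi * Real.exp (t * n) := by
    rw [div_mul_eq_mul_div, le_div_iff₀ Real.pi_pos]
    refine le_of_mul_le_mul_right ?_ (Real.exp_pos (-(2 * (n : ℝ)) - 2))
    linarith
  have : (0 : ℝ) ≤ hfin₀.toFinset.card * Real.exp (t * n) := by positivity
  linarith

/-- If `Γ ≤ SL(2,ℝ)` is discrete, the orbit `Γ·i` is bounded in `ℂ`, the limit set has at least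
3 points, and `V(L(Γ)_r) ≤ C·r^(2−t)` for all `0 < r < r₀`, then for every `s > t` the Poincaré
series `Σ_{g ∈ Γ} exp(−s·d(i, g·i))` converges. -/
theorem summable_poincareSeries_of_volume_bound
    (Γ : Subgroup (Matrix.SpecialLinearGroup (Fin 2) ℝ))
    (hdisc : IsDiscreteSubgroup Γ)
    (hbdd : Bornology.IsBounded (orbitOfI Γ))
    (hnonelem : ∃ a b c : ℂ, a ∈ limitSet Γ ∧ b ∈ limitSet Γ ∧ c ∈ limitSet Γ ∧
      a ≠ b ∧ a ≠ c ∧ b ≠ c)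
    (t : ℝ) (ht : 0 ≤ t) (C : ℝ) (hC : 0 < C) (r₀ : ℝ) (hr₀ : 0 < r₀)
    (hvol : ∀ r : ℝ, 0 < r → r < r₀ →
      volume (cthickening r (limitSet Γ)) ≤ ENNReal.ofReal (C * r ^ (2 - t)))
    (s : ℝ) (hs : t < s) :
    Summable fun g : Γ =>
      Real.exp (-s * dist UpperHalfPlane.I
        ((g : Matrix.SpecialLinearGroup (Fin 2) ℝ) • UpperHalfPlane.I)) := by
  obtain ⟨a, b, -, ha, hb, -, hab, -, -⟩ := hnonelem
  obtain ⟨K, hK, hcard⟩ :=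
    exists_card_shell_le hdisc hbdd ⟨a, ha, b, hb, hab⟩ ht hC hr₀ hvol
  set φ : Γ → ℕ := fun g => ⌊dist I ((g : SL(2, ℝ)) • I)⌋₊ with hφ
  have hgeom : Summable fun n : ℕ => K * Real.exp (n * (t - s)) :=
    (Real.summable_exp_nat_mul_iff.2 (by linarith)).mul_left K
  refine summable_of_sum_le (c := ∑' n : ℕ, K * Real.exp (n * (t - s)))
    (fun g => (Real.exp_pos _).le) fun F => ?_
  rw [← Finset.sum_fiberwise_of_maps_to (fun g hg => Finset.mem_image_of_mem φ hg)]
  refine (Finset.sum_le_sum fun n _ => ?_).trans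
    (hgeom.sum_le_tsum (F.image φ) fun n _ => mul_nonneg hK (Real.exp_pos _).le)
  have hshell : ∀ g ∈ F.filter (φ · = n),
      n ≤ dist I ((g : SL(2, ℝ)) • I) ∧ dist I ((g : SL(2, ℝ)) • I) < n + 1 := fun g hg =>
    (Nat.floor_eq_iff dist_nonneg).1 (Finset.mem_filter.1 hg).2
  calc _ ≤ (F.filter (φ · = n)).card • Real.exp (-s * n) :=
        Finset.sum_le_card_nsmul _ _ _ fun g hg => Real.exp_le_exp.2
          (mul_le_mul_of_nonpos_left (hshell g hg).1 (by linarith))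
    _ ≤ K * Real.exp (t * n) * Real.exp (-s * n) := by
        rw [nsmul_eq_mul]
        gcongr
        exact hcard n _ hshell
    _ = K * Real.exp (n * (t - s)) := by
        rw [mul_assoc, ← Real.exp_add]
        ring_nf
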